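/- (Wang's master symmetry criterion.) Let α ∈ ℂ, κ > 1 a constant, and K ∈ 𝒜 such that [u₁, K] = 0 and [x u₁ + α u₀, K] = κ K. Set e = u₁, f = −(x²u₁ + 2α x u₀), τ = (1/(2κ))[x²u₁ + 2α x u₀, K], and define recursively a₀ = e, a_{n+1} = [τ, a_n]. Assume (i) [[τ,K],K] = 0, and (ii) there is a Lie subalgebra 𝔥 of (𝒜, [·,·]) containing all a_n (n = 0,1,2,…) such that any P, Q ∈ 𝔥 with [P,e] = [Q,e] = [P,K] = [Q,K] = 0 satisfy [P,Q] = 0. Then all the a_n mutually commute: [a_m, a_n] = 0 for all m, n ≥ 0; in particular τ is a master symmetry of u_t = K. -/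

import Mathlib

open MvPolynomial

/-- The differential ring `𝒜 = ℂ[x, u₀, u₁, u₂, …]`: variable `none` is `x`,
variable `some k` is `u_k` (the `k`-th `x`-derivative of `u`). -/
abbrev A : Type := MvPolynomial (Option ℕ) ℂ

/-- The variable `x`. -/
noncomputable def Xx : A := X none

/-- The variable `u_k`. -/
noncomputable def U (k : ℕ) : A := X (some k)

/-- The total derivative `D_x = ∂/∂x + Σ_{k≥0} u_{k+1} ∂/∂u_k`. -/
noncomputable def Dx (P : A) : A :=
  pderiv (none : Option ℕ) P + ∑ᶠ k : ℕ, U (k + 1) * pderiv (some k) P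

/-- The Fréchet derivative of `P` applied to `Q`: `P_*(Q) = Σ_k (∂P/∂u_k) D_x^k(Q)`. -/
noncomputable def frechet (P Q : A) : A :=
  ∑ᶠ k : ℕ, pderiv (some k) P * Dx^[k] Q

/-- The bracket `[P,Q] = Q_*(P) − P_*(Q)`. -/
noncomputable def lieBr (P Q : A) : A := frechet Q P - frechet P Q

/-- A derivation of `A` is determined by its values on the variables via partial derivatives. -/
theorem mkDerivation_eq_pderiv_add_finsum (f : Option ℕ → A) (P : A) :
    mkDerivation ℂ f P =
      pderiv none P * f none + ∑ᶠ k : ℕ, pderiv (some k) P * f (some k) := by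
  have hs : (Function.support fun k : ℕ => pderiv (some k) P * f (some k)) ⊆
      (Finset.eraseNone P.vars : Finset ℕ) := by
    intro k hk
    by_contra hk'
    refine hk ?_
    have : some k ∉ P.vars := by simpa using hk'
    simp [pderiv_eq_zero_of_notMem_vars this]
  rw [finsum_eq_sum_of_support_subset _ hs]
  let D : Derivation ℂ A A := mkDerivation ℂ f -
    (f none • pderiv none + ∑ k ∈ Finset.eraseNone P.vars, f (some k) • pderiv (some k))
  have hsum : ∀ Q, (∑ k ∈ Finset.eraseNone P.vars, f (some k) • pderiv (R := ℂ) (some k)) Q =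
      ∑ k ∈ Finset.eraseNone P.vars, f (some k) * pderiv (some k) Q := by
    intro Q
    rw [← Derivation.coeFnAddMonoidHom_apply, map_sum, Finset.sum_apply]
    rfl
  have hD : D P = 0 := by
    refine derivation_eq_zero_of_forall_mem_vars fun i hi => ?_
    simp only [D, Derivation.sub_apply, Derivation.add_apply, hsum, Derivation.smul_apply,
      mkDerivation_X, smul_eq_mul]
    cases i with
    | none => simp [pderiv_X]
    | some j =>
      rw [Finset.sum_eq_single_of_mem j (by simpa using hi)]
      · simp [pderiv_X]
      · intro k _ hk
        simp [pderiv_X, hk.symm]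
  simp only [D, Derivation.sub_apply, Derivation.add_apply, hsum, Derivation.smul_apply,
    smul_eq_mul, sub_eq_zero] at hD
  simp only [hD, mul_comm]

/-- The total derivative as a derivation. -/
noncomputable def totalDerivation : Derivation ℂ A A :=
  mkDerivation ℂ fun i => i.elim 1 fun k => U (k + 1)

theorem Dx_eq_totalDerivation (P : A) : Dx P = totalDerivation P := by
  simp [Dx, totalDerivation, mkDerivation_eq_pderiv_add_finsum, mul_comm]

/-- The evolutionary derivation with characteristic `P`. -/
noncomputable def evolutionary (P : A) : Derivation ℂ A A :=
  mkDerivation ℂ fun i => i.elim 0 fun k => Dx^[k] P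

theorem frechet_eq_evolutionary (P Q : A) : frechet P Q = evolutionary Q P := by
  simp [frechet, evolutionary, mkDerivation_eq_pderiv_add_finsum]

theorem lieBr_eq (P Q : A) : lieBr P Q = evolutionary P Q - evolutionary Q P := by
  simp only [lieBr, frechet_eq_evolutionary]

theorem evolutionary_Xx (P : A) : evolutionary P Xx = 0 := by
  simp [evolutionary, Xx]

theorem evolutionary_U (P : A) (k : ℕ) : evolutionary P (U k) = Dx^[k] P := by
  simp [evolutionary, U]

theorem Dx_Xx : Dx Xx = 1 := by
  simp [Dx_eq_totalDerivation, totalDerivation, Xx]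

theorem Dx_U (k : ℕ) : Dx (U k) = U (k + 1) := by
  simp [Dx_eq_totalDerivation, totalDerivation, U]

theorem evolutionary_Dx (P Q : A) : evolutionary P (Dx Q) = Dx (evolutionary P Q) := by
  have h : ⁅evolutionary P, totalDerivation⁆ = 0 := by
    refine derivation_ext fun i => ?_
    rw [Derivation.commutator_apply, ← Dx_eq_totalDerivation, ← Dx_eq_totalDerivation]
    cases i with
    | none =>
      change evolutionary P (Dx Xx) - Dx (evolutionary P Xx) = 0
      rw [Dx_Xx, evolutionary_Xx, Dx_eq_totalDerivation, map_zero, Derivation.map_one_eq_zero, sub_zero]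
    | some k =>
      change evolutionary P (Dx (U k)) - Dx (evolutionary P (U k)) = 0
      rw [Dx_U, evolutionary_U, evolutionary_U, Function.iterate_succ_apply', sub_self]
  have := DFunLike.congr_fun h Q
  rwa [Derivation.commutator_apply, ← Dx_eq_totalDerivation, ← Dx_eq_totalDerivation,
    Derivation.zero_apply, sub_eq_zero] at this

theorem evolutionary_iterate_Dx (P Q : A) (k : ℕ) :
    evolutionary P (Dx^[k] Q) = Dx^[k] (evolutionary P Q) :=
  (Function.Commute.iterate_right (f := evolutionary P) (evolutionary_Dx P) k) Q

theorem iterate_Dx_sub (P Q : A) (k : ℕ) : Dx^[k] (P - Q) = Dx^[k] P - Dx^[k] Q := by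
  have h : Dx = totalDerivation := funext Dx_eq_totalDerivation
  rw [h]
  exact iterate_map_sub totalDerivation k P Q

/-- Passing to the evolutionary derivation turns `lieBr` into the commutator. -/
theorem evolutionary_lieBr (P Q R : A) :
    evolutionary (lieBr P Q) R =
      evolutionary P (evolutionary Q R) - evolutionary Q (evolutionary P R) := by
  have h : evolutionary (lieBr P Q) = ⁅evolutionary P, evolutionary Q⁆ := by
    refine derivation_ext fun i => ?_
    rw [Derivation.commutator_apply]
    cases i with
    | none =>
      change evolutionary _ Xx = evolutionary P (evolutionary Q Xx) -
        evolutionary Q (evolutionary P Xx)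
      simp [evolutionary_Xx]
    | some k =>
      change evolutionary _ (U k) = evolutionary P (evolutionary Q (U k)) -
        evolutionary Q (evolutionary P (U k))
      simp only [evolutionary_U, evolutionary_iterate_Dx, lieBr_eq, iterate_Dx_sub]
  rw [h, Derivation.commutator_apply]

theorem lieBr_antisymm (P Q : A) : lieBr P Q = -lieBr Q P := by
  simp [lieBr]

theorem lieBr_zero (P : A) : lieBr P 0 = 0 := by
  have h := evolutionary_lieBr P P P
  have : lieBr P P = 0 := by simp [lieBr]
  rw [this, sub_self] at h
  simp [lieBr_eq, h]

/-- The Jacobi identity for `lieBr`, in Leibniz form. -/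
theorem lieBr_leibniz (P Q R : A) :
    lieBr P (lieBr Q R) = lieBr (lieBr P Q) R + lieBr Q (lieBr P R) := by
  rw [lieBr_eq P, lieBr_eq (lieBr P Q), lieBr_eq Q (lieBr P R)]
  simp only [evolutionary_lieBr]
  simp only [lieBr_eq, map_sub]
  ring

theorem evolutionary_smul (c : ℂ) (P Q : A) :
    evolutionary (c • P) Q = c • evolutionary P Q := by
  have h : Dx = totalDerivation := funext Dx_eq_totalDerivation
  have h' : evolutionary (c • P) = c • evolutionary P := by
    refine derivation_ext fun i => ?_
    cases i with
    | none =>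
      change evolutionary _ Xx = c • evolutionary _ Xx
      simp [evolutionary_Xx]
    | some k =>
      change evolutionary _ (U k) = c • evolutionary _ (U k)
      rw [evolutionary_U, evolutionary_U, h]
      induction k with
      | zero => rfl
      | succ k ih => simp only [Function.iterate_succ_apply', ih, Derivation.map_smul]
  rw [h', Derivation.smul_apply]

theorem lieBr_smul (c : ℂ) (P Q : A) : lieBr P (c • Q) = c • lieBr P Q := by
  simp only [lieBr_eq, Derivation.map_smul, evolutionary_smul, smul_sub]

theorem smul_lieBr (c : ℂ) (P Q : A) : lieBr (c • P) Q = c • lieBr P Q := by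
  simp only [lieBr_eq, Derivation.map_smul, evolutionary_smul, smul_sub]

theorem lieBr_U_one_quadratic (α : ℂ) :
    lieBr (U 1) (Xx ^ 2 * U 1 + 2 * C α * Xx * U 0) =
      (-2 : ℂ) • (Xx * U 1 + C α * U 0) := by
  have hC : totalDerivation (C α) = 0 := derivation_C _ _
  have hC' : evolutionary (U 1) (C α) = 0 := derivation_C _ _
  have h2 (D : Derivation ℂ A A) : D 2 = 0 := by
    simpa using D.map_natCast 2
  have hx := Dx_Xx
  have h0 := Dx_U 0
  have h1 := Dx_U 1
  rw [Dx_eq_totalDerivation] at hx h0 h1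
  rw [lieBr_eq, evolutionary_U, Function.iterate_one, Dx_eq_totalDerivation]
  simp only [map_add, Derivation.leibniz, Derivation.leibniz_pow, evolutionary_Xx,
    evolutionary_U, hx, h0, h1, hC, hC', h2, Dx_U, Function.iterate_one,
    Function.iterate_zero_apply, smul_eq_mul, nsmul_eq_mul, MvPolynomial.smul_eq_C_mul]
  simp only [map_neg, map_ofNat]
  push_cast
  ring

/-- Wang's master symmetry criterion: for a homogeneous equation `u_t = K` with
`[u₁,K] = 0`, `[x u₁ + α u₀, K] = κ K`, `κ > 1`, with
`τ = (1/(2κ))[x² u₁ + 2α x u₀, K]` and `a₀ = u₁`, `a_{n+1} = [τ, a_n]`, if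
`[[τ,K],K] = 0` and there is a Lie subalgebra `𝔥` containing all `a_n` in which
any two elements commuting with both `u₁` and `K` commute with each other,
then all the `a_n` mutually commute. -/
theorem wang_master_symmetry_criterion (α : ℂ) (κ : ℝ) (hκ : 1 < κ)
    (K : A)
    (hK1 : lieBr (U 1) K = 0)
    (hK2 : lieBr (Xx * U 1 + C α * U 0) K = (κ : ℂ) • K)
    (τ : A)
    (hτ : τ = (1 / (2 * (κ : ℂ))) • lieBr (Xx ^ 2 * U 1 + 2 * C α * Xx * U 0) K)
    (a : ℕ → A) (ha0 : a 0 = U 1) (haS : ∀ n, a (n + 1) = lieBr τ (a n))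
    (hmaster : lieBr (lieBr τ K) K = 0)
    (𝔥 : Submodule ℂ A)
    (hclosed : ∀ P ∈ 𝔥, ∀ Q ∈ 𝔥, lieBr P Q ∈ 𝔥)
    (hmem : ∀ n, a n ∈ 𝔥)
    (hcomm : ∀ P ∈ 𝔥, ∀ Q ∈ 𝔥,
      lieBr P (U 1) = 0 → lieBr Q (U 1) = 0 → lieBr P K = 0 → lieBr Q K = 0 →
        lieBr P Q = 0) :
    ∀ m n, lieBr (a m) (a n) = 0 := by
  have hκ0 : (κ : ℂ) ≠ 0 := by
    exact_mod_cast (by linarith : κ ≠ 0)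
  have heτ : lieBr (U 1) τ = -K := by
    rw [hτ, lieBr_smul, lieBr_leibniz, hK1, lieBr_zero, add_zero, lieBr_U_one_quadratic,
      smul_lieBr, hK2, smul_smul, smul_smul, ← neg_one_smul ℂ K]
    congr 1
    field_simp
  have ha1 : a 1 = K := by
    rw [haS 0, ha0, lieBr_antisymm, heτ, neg_neg]
  have ha2 : a 2 = lieBr τ K := by
    rw [haS 1, ha1]
  have hstep (n : ℕ) (he : lieBr (a n) (U 1) = 0) (hK : lieBr (a n) K = 0) :
      lieBr (a (n + 1)) (U 1) = 0 := by
    rw [lieBr_antisymm, neg_eq_zero] at he hK ⊢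
    rw [haS, lieBr_leibniz, heτ, he, lieBr_zero, add_zero, ← neg_one_smul ℂ K, smul_lieBr,
      hK, smul_zero]
  have he2 : lieBr (a 2) (U 1) = 0 := by
    refine hstep 1 ?_ ?_
    · rw [ha1, lieBr_antisymm, hK1, neg_zero]
    · simp [ha1, lieBr]
  have hall (n : ℕ) : lieBr (a n) (U 1) = 0 ∧ lieBr (a n) K = 0 := by
    induction n with
    | zero => exact ⟨by simp [ha0, lieBr], by rw [ha0, hK1]⟩
    | succ n ih =>
      refine ⟨hstep n ih.1 ih.2, ?_⟩
      have h2n : lieBr (a n) (a 2) = 0 :=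
        hcomm _ (hmem n) _ (hmem 2) ih.1 he2 ih.2 (by rw [ha2, hmaster])
      have hj := lieBr_leibniz (a n) τ K
      rw [← ha2, h2n, ih.2, lieBr_zero, add_zero, lieBr_antisymm (a n) τ, ← haS,
        ← neg_one_smul ℂ (a (n + 1)), smul_lieBr, neg_one_smul, eq_comm, neg_eq_zero] at hj
      exact hj
  exact fun m n => hcomm _ (hmem m) _ (hmem n) (hall m).1 (hall n).1 (hall m).2 (hall n).2
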